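/- arXiv:1806.07579 — 2 statements merged into one kernel-verified Lean document; each statement's English description precedes it below -/
import Mathlib

section
/- Let p be an odd prime. For every integer r with 0 ≤ r ≤ 2t, the number N_r of r-tuples (x_1, …, x_r) ∈ (F_{q²}^*)^r satisfying x_1^{d̃_j} + x_2^{d̃_j} + ⋯ + x_r^{d̃_j} = 0 simultaneously for all 1 ≤ j ≤ t is given by: N_0 = 1, N_1 = 0, and for r ≥ 2, N_r = r!·e^r·Σ_λ C((q+1)/e, L)·L!·Π_{j≥2} (B_j/j!)^{λ_j}/(λ_j)!, where the sum is over all tuples of nonnegative integers λ = (λ_2, λ_3, …) with Σ_{j≥2} j·λ_j = r, L = Σ_{j≥2} λ_j, B_j = q^{−1}(q−1)^j + (−1)^j(1 − q^{−1}), and C(·,·) is the binomial coefficient. -/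
open Finset in
theorem sum_prod_card_fiber {ι V : Type*} [Fintype ι] [DecidableEq ι] [Fintype V] [DecidableEq V]
    (b : ℕ → ℚ) :
    ∑ f : ι → V, ∏ v, b (Fintype.card {i // f i = v}) =
      ∑ n ∈ piAntidiag (univ : Finset V) (Fintype.card ι),
        (Nat.multinomial univ n : ℚ) * ∏ v, b (n v) := by
  have key : ∑ f : ι → V, MvPolynomial.monomial
        (Finsupp.equivFunOnFinite.symm fun v => Fintype.card {i // f i = v}) (1 : ℚ) =
      ∑ n ∈ piAntidiag (univ : Finset V) (Fintype.card ι),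
        (Nat.multinomial univ n : ℚ) •
          MvPolynomial.monomial (Finsupp.equivFunOnFinite.symm n) (1 : ℚ) := by
    have hmon (n : V → ℕ) : MvPolynomial.monomial (Finsupp.equivFunOnFinite.symm n) (1 : ℚ) =
        ∏ v, (MvPolynomial.X v : MvPolynomial V ℚ) ^ n v := by
      rw [MvPolynomial.monomial_eq, Finsupp.prod_fintype _ _ (by simp)]
      simp
    simp_rw [hmon]
    have h := sum_pow_eq_sum_piAntidiag (univ : Finset V)
      (fun v => (MvPolynomial.X v : MvPolynomial V ℚ)) (Fintype.card ι)
    rw [← Finset.card_univ, ← Finset.prod_const, Finset.prod_univ_sum] at h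
    simp only [Fintype.piFinset_univ] at h
    rw [← Finset.card_univ]
    convert h using 1
    · refine Finset.sum_congr rfl fun f _ => ?_
      rw [← Finset.prod_fiberwise (univ : Finset ι) f]
      refine Finset.prod_congr rfl fun v _ => ?_
      rw [Finset.prod_congr rfl (g := fun _ => MvPolynomial.X v)
        (by intro i hi; rw [(Finset.mem_filter.1 hi).2]), Finset.prod_const, Fintype.card_subtype]
    · refine Finset.sum_congr rfl fun n _ => ?_
      rw [Algebra.smul_def]
      simp
  have := congrArg ((MvPolynomial.basisMonomials V ℚ).constr ℚ
    fun m : V →₀ ℕ => ∏ v, b (m v)) key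
  have hc (m : V →₀ ℕ) : (MvPolynomial.basisMonomials V ℚ).constr ℚ
    (fun m : V →₀ ℕ => ∏ v, b (m v)) (MvPolynomial.monomial m 1) = ∏ v, b (m v) := by
    rw [← congrFun (MvPolynomial.coe_basisMonomials V ℚ) m, Module.Basis.constr_basis]
  simpa only [map_sum, map_smul, hc, smul_eq_mul, Finsupp.equivFunOnFinite_symm_apply_apply]
    using this

open Finset in
theorem sum_prod_card_fiber_eq_factorial_mul_coeff {ι V : Type*} [Fintype ι] [DecidableEq ι]
    [Fintype V] [DecidableEq V] (b : ℕ → ℚ) :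
    ∑ f : ι → V, ∏ v, b (Fintype.card {i // f i = v}) =
      ((Fintype.card ι).factorial : ℚ) * PowerSeries.coeff (Fintype.card ι)
        ((PowerSeries.mk fun n => b n / (n.factorial : ℚ)) ^ Fintype.card V) := by
  rw [sum_prod_card_fiber, ← Finset.card_univ (α := V), ← Finset.prod_const,
    PowerSeries.coeff_prod, Finset.mul_sum]
  refine Finset.sum_bij' (fun n _ => Finsupp.equivFunOnFinite.symm n) (fun n _ => ⇑n) ?_ ?_ ?_ ?_ ?_
  · intro n hn
    simpa [mem_finsuppAntidiag] using hn
  · intro n hn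
    simpa [mem_finsuppAntidiag] using hn
  · intro n hn
    simp
  · intro n hn
    ext; simp
  · intro n hn
    have h := Nat.multinomial_spec univ n
    rw [(mem_piAntidiag.1 hn).1] at h
    simp only [PowerSeries.coeff_mk, Finsupp.equivFunOnFinite_symm_apply_apply, Finset.prod_div_distrib]
    rw [← h]
    push_cast
    have : ∏ v, ((n v).factorial : ℚ) ≠ 0 :=
      Finset.prod_ne_zero_iff.2 fun v _ => by exact_mod_cast Nat.factorial_ne_zero _
    field_simp

open Finset in
theorem coeff_pow_eq_sum_partitions (c : ℕ → ℚ) (h0 : c 0 = 1) (h1 : c 1 = 0) (M r : ℕ) :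
    PowerSeries.coeff r ((PowerSeries.mk c) ^ M) =
      ∑ fl ∈ Finset.univ.filter (fun fl : Fin (r + 1) → Fin (r + 1) =>
            (∀ j : Fin (r + 1), (j : ℕ) < 2 → fl j = 0) ∧
            ∑ j : Fin (r + 1), (j : ℕ) * (fl j : ℕ) = r),
          (M.choose (∑ j, (fl j : ℕ)) : ℚ) * ((∑ j, (fl j : ℕ)).factorial : ℚ) *
            ∏ j : Fin (r + 1), c j ^ (fl j : ℕ) / ((fl j : ℕ).factorial : ℚ) := by
  set s : Finset (Fin (r + 1)) := univ.filter fun j => 2 ≤ (j : ℕ) with hs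
  set g : Polynomial ℚ := ∑ j ∈ s, Polynomial.monomial (j : ℕ) (c j) with hg
  have hP : ∀ n ≤ r, PowerSeries.coeff n (PowerSeries.mk c) = (g + 1).coeff n := by
    intro n hn
    simp only [PowerSeries.coeff_mk, hg, Polynomial.coeff_add, Polynomial.finsetSum_coeff,
      Polynomial.coeff_monomial, Polynomial.coeff_one]
    by_cases h2 : 2 ≤ n
    · rw [Finset.sum_eq_single_of_mem ⟨n, by omega⟩ (by simp [hs, h2])]
      · simp; omega
      · intro j _ hj
        rw [if_neg]
        rintro rfl
        exact hj rfl
    · rw [Finset.sum_eq_zero]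
      · have : n = 0 ∨ n = 1 := by omega
        rcases this with rfl | rfl <;> simp [h0, h1]
      · intro j hj
        have : 2 ≤ (j : ℕ) := by simpa [hs] using hj
        rw [if_neg (by omega)]
  have hcoe : PowerSeries.coeff r ((PowerSeries.mk c) ^ M) = ((g + 1) ^ M).coeff r := by
    rw [← Polynomial.coeff_coe, Polynomial.coe_pow, PowerSeries.coeff_pow, PowerSeries.coeff_pow]
    refine Finset.sum_congr rfl fun l hl => Finset.prod_congr rfl fun i hi => ?_
    rw [Polynomial.coeff_coe]
    apply hP
    rw [← (mem_finsuppAntidiag.1 hl).1]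
    exact Finset.single_le_sum (f := fun i => l i) (fun _ _ => Nat.zero_le _) hi
  have hgL (L : ℕ) : (g ^ L).coeff r = ∑ k ∈ (piAntidiag s L).filter
      (fun k => ∑ j : Fin (r + 1), (j : ℕ) * k j = r),
      (L.factorial : ℚ) * ∏ j : Fin (r + 1), c j ^ (k j) / ((k j).factorial : ℚ) := by
    rw [hg, sum_pow_eq_sum_piAntidiag, Polynomial.finsetSum_coeff, Finset.sum_filter]
    refine Finset.sum_congr rfl fun k hk => ?_
    obtain ⟨hk1, hk2⟩ := mem_piAntidiag.1 hk
    have hks : ∀ j ∉ s, k j = 0 := fun j hj => by_contra fun h => hj (hk2 j h)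
    have hm := Nat.multinomial_spec s k
    rw [hk1] at hm
    have hpr : ∏ j ∈ s, (Polynomial.monomial (j : ℕ) (c j)) ^ k j =
        Polynomial.monomial (∑ j : Fin (r + 1), (j : ℕ) * k j)
          (∏ j : Fin (r + 1), c j ^ k j) := by
      rw [← Finset.sum_subset (subset_univ s), ← Finset.prod_subset (subset_univ s)]
      · simp_rw [Polynomial.monomial_pow, ← Polynomial.C_mul_X_pow_eq_monomial, map_prod,
          ← Finset.prod_pow_eq_pow_sum, Finset.prod_mul_distrib]
      · intro j _ hj; simp [hks j hj]
      · intro j _ hj; simp [hks j hj]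
    rw [hpr, ← Polynomial.C_eq_natCast, Polynomial.coeff_C_mul, Polynomial.coeff_monomial]
    split_ifs
    · rw [← hm, Finset.prod_div_distrib, ← Finset.prod_subset (subset_univ s)
        (f := fun j => ((k j).factorial : ℚ))]
      · push_cast
        have : ∏ v ∈ s, ((k v).factorial : ℚ) ≠ 0 :=
          Finset.prod_ne_zero_iff.2 fun v _ => by exact_mod_cast Nat.factorial_ne_zero _
        field_simp
      · intro j _ hj; simp [hks j hj]
    · simp
  rw [hcoe, add_pow, Polynomial.finsetSum_coeff]
  have hterm (L : ℕ) : (g ^ L * 1 ^ (M - L) * (M.choose L : Polynomial ℚ)).coeff r =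
      ∑ k ∈ (piAntidiag s L).filter (fun k => ∑ j : Fin (r + 1), (j : ℕ) * k j = r),
      (M.choose L : ℚ) * ((L.factorial : ℚ) *
        ∏ j : Fin (r + 1), c j ^ (k j) / ((k j).factorial : ℚ)) := by
    rw [one_pow, mul_one, ← Polynomial.C_eq_natCast, Polynomial.coeff_mul_C, hgL, mul_comm,
      Finset.mul_sum]
  simp_rw [hterm]
  rw [Finset.sum_sigma']
  rw [← Finset.sum_filter_add_sum_filter_not (filter _ _)
    (fun fl : Fin (r + 1) → Fin (r + 1) => ∑ j, (fl j : ℕ) ≤ M)]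
  rw [Finset.sum_eq_zero (s := filter (fun fl => ¬ _) _), add_zero]
  swap
  · intro fl hfl
    rw [Nat.choose_eq_zero_of_lt (not_le.1 (mem_filter.1 hfl).2)]
    simp
  have hlt {L : ℕ} {k : Fin (r + 1) → ℕ} (hk : k ∈ piAntidiag s L)
      (hr : ∑ j : Fin (r + 1), (j : ℕ) * k j = r) (j : Fin (r + 1)) :
      ((Fin.ofNat (r + 1) (k j) : Fin (r + 1)) : ℕ) = k j := by
    rw [Fin.val_ofNat, Nat.mod_eq_of_lt]
    by_cases hj : k j = 0
    · omega
    · have h2 : 2 ≤ (j : ℕ) := by simpa [hs] using (mem_piAntidiag.1 hk).2 j hj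
      have := Finset.single_le_sum (f := fun j : Fin (r + 1) => (j : ℕ) * k j)
        (fun _ _ => Nat.zero_le _) (mem_univ j)
      simp only [hr] at this
      nlinarith
  have hsum {L : ℕ} {k : Fin (r + 1) → ℕ} (hk : k ∈ piAntidiag s L) : ∑ j, k j = L := by
    rw [← (mem_piAntidiag.1 hk).1]
    refine (Finset.sum_subset (subset_univ s) fun j _ hj => ?_).symm
    by_contra h
    exact hj ((mem_piAntidiag.1 hk).2 j h)
  refine Finset.sum_bij' (fun x _ => fun j => Fin.ofNat (r + 1) (x.2 j))
    (fun fl _ => ⟨∑ j, (fl j : ℕ), fun j => fl j⟩) ?_ ?_ ?_ ?_ ?_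
  · rintro ⟨L, k⟩ hx
    simp only [mem_sigma, mem_filter, mem_range] at hx
    obtain ⟨hL, hk, hr⟩ := hx
    simp only [mem_filter, mem_univ, true_and, hlt hk hr, hr, hsum hk, and_true]
    refine ⟨fun j hj => ?_, by omega⟩
    apply Fin.ext
    rw [hlt hk hr]
    by_contra h
    have h2 : 2 ≤ (j : ℕ) := by simpa [hs] using (mem_piAntidiag.1 hk).2 j h
    omega
  · intro fl hfl
    simp only [mem_filter, mem_univ, true_and] at hfl
    obtain ⟨⟨h1, h2⟩, h3⟩ := hfl
    have hz : ∀ j ∉ s, fl j = 0 := fun j hj => h1 j (by simpa [hs] using hj)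
    simp only [mem_sigma, mem_filter, mem_range, mem_piAntidiag]
    refine ⟨by omega, ⟨?_, fun j hj => ?_⟩, h2⟩
    · exact Finset.sum_subset (subset_univ s) fun j _ hj => by simp [hz j hj]
    · by_contra h
      exact hj (by simp [hz j h])
  · rintro ⟨L, k⟩ hx
    simp only [mem_sigma, mem_filter, mem_range] at hx
    obtain ⟨hL, hk, hr⟩ := hx
    simp only [hlt hk hr, hsum hk]
  · intro fl hfl
    ext j
    simp
  · rintro ⟨L, k⟩ hx
    simp only [mem_sigma, mem_filter, mem_range] at hx
    obtain ⟨hL, hk, hr⟩ := hx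
    simp only [hlt hk hr, hsum hk]
    ring

theorem card_zero_sum_fin_succ_add (S : Type*) [AddCommGroup S] [Fintype S] (n : ℕ) :
    Nat.card {x : Fin (n + 1) → {s : S // s ≠ 0} // ∑ i, (x i : S) = 0} +
      Nat.card {x : Fin n → {s : S // s ≠ 0} // ∑ i, (x i : S) = 0} =
        (Fintype.card S - 1) ^ n := by
  classical
  have e : {x : Fin (n + 1) → {s : S // s ≠ 0} // ∑ i, (x i : S) = 0} ≃
      {x : Fin n → {s : S // s ≠ 0} // ¬ ∑ i, (x i : S) = 0} :=
    { toFun := fun x => ⟨Fin.tail x.1, fun h => (x.1 0).2 (by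
        have := x.2
        rw [Fin.sum_univ_succ] at this
        simp only [Fin.tail] at h
        rwa [h, add_zero] at this)⟩
      invFun := fun y => ⟨Fin.cons ⟨-∑ i, (y.1 i : S), neg_ne_zero.2 y.2⟩ y.1, by
        simp [Fin.sum_univ_succ]⟩
      left_inv := fun x => by
        have := x.2
        rw [Fin.sum_univ_succ] at this
        ext i
        refine Fin.cases ?_ (fun i => ?_) i
        · simpa [Fin.tail] using (eq_neg_of_add_eq_zero_left this).symm
        · simp [Fin.tail]
      right_inv := fun y => by
        ext i
        simp [Fin.tail] }
  rw [Nat.card_congr e, Nat.card_eq_fintype_card, Nat.card_eq_fintype_card,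
    Fintype.card_subtype_compl, Nat.sub_add_cancel (Fintype.card_subtype_le _)]
  simp

theorem card_zero_sum (S : Type*) [AddCommGroup S] [Fintype S] (ι : Type*) [Fintype ι] :
    (Nat.card {x : ι → {s : S // s ≠ 0} // ∑ i, (x i : S) = 0} : ℚ) =
      ((Fintype.card S : ℚ) - 1) ^ Fintype.card ι / Fintype.card S +
        (-1) ^ Fintype.card ι * (1 - 1 / (Fintype.card S : ℚ)) := by
  have hS : 1 ≤ Fintype.card S := Fintype.card_pos
  have hS0 : (Fintype.card S : ℚ) ≠ 0 := by exact_mod_cast (by omega : Fintype.card S ≠ 0)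
  have e := Fintype.equivFin ι
  have : {x : ι → {s : S // s ≠ 0} // ∑ i, (x i : S) = 0} ≃
      {x : Fin (Fintype.card ι) → {s : S // s ≠ 0} // ∑ i, (x i : S) = 0} :=
    (Equiv.arrowCongr e (Equiv.refl _)).subtypeEquiv fun x => by
      simp [Equiv.sum_comp e.symm (fun i => (x i : S))]
  rw [Nat.card_congr this]
  generalize Fintype.card ι = n
  induction n with
  | zero => simp
  | succ n ih =>
    have h := card_zero_sum_fin_succ_add S n
    have h' := congrArg (Nat.cast : ℕ → ℚ) h
    push_cast [Nat.cast_sub hS] at h'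
    rw [ih] at h'
    rw [eq_sub_of_add_eq h']
    field_simp
    ring

theorem card_fun_comp {ι G Y : Type*} [Fintype ι] [Fintype G] [Fintype Y] (Φ : G → Y) (e : ℕ)
    (hΦ : ∀ y, Nat.card {x // Φ x = y} = e) (P : (ι → Y) → Prop) :
    Nat.card {x : ι → G // P (Φ ∘ x)} = e ^ Fintype.card ι * Nat.card {y : ι → Y // P y} := by
  classical
  have E : {x : ι → G // P (Φ ∘ x)} ≃
      Σ y : {y : ι → Y // P y}, ∀ i, {g : G // Φ g = y.1 i} :=
    { toFun := fun x => ⟨⟨Φ ∘ x.1, x.2⟩, fun i => ⟨x.1 i, rfl⟩⟩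
      invFun := fun z => ⟨fun i => (z.2 i).1, by
        have : (Φ ∘ fun i => (z.2 i).1) = z.1.1 := funext fun i => (z.2 i).2
        rw [this]
        exact z.1.2⟩
      left_inv := fun x => rfl
      right_inv := fun z => by
        obtain ⟨⟨y, hy⟩, z⟩ := z
        obtain ⟨w, hw, rfl⟩ : ∃ (w : ι → G) (hw : ∀ i, Φ (w i) = y i), z = fun i => ⟨w i, hw i⟩ :=
          ⟨fun i => (z i).1, fun i => (z i).2, rfl⟩
        obtain rfl : (fun i => Φ (w i)) = y := funext hw
        rfl }
  rw [Nat.card_congr E, Nat.card_sigma]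
  simp_rw [Nat.card_pi, hΦ]
  rw [Finset.sum_const, Finset.prod_const, Finset.card_univ, Finset.card_univ, smul_eq_mul,
    Nat.card_eq_fintype_card, mul_comm]

theorem card_fiberwise_zero_sum {ι V S : Type*} [Fintype ι] [DecidableEq ι] [Fintype V]
    [DecidableEq V] [AddCommGroup S] [Fintype S] :
    Nat.card {y : ι → V × {s : S // s ≠ 0} //
        ∀ v, ∑ i : {i // (y i).1 = v}, ((y i).2 : S) = 0} =
      ∑ f : ι → V, ∏ v,
        Nat.card {x : {i // f i = v} → {s : S // s ≠ 0} // ∑ i, (x i : S) = 0} := by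
  classical
  have E : {y : ι → V × {s : S // s ≠ 0} //
        ∀ v, ∑ i : {i // (y i).1 = v}, ((y i).2 : S) = 0} ≃
      Σ f : ι → V, ∀ v, {x : {i // f i = v} → {s : S // s ≠ 0} // ∑ i, (x i : S) = 0} :=
    { toFun := fun y => ⟨fun i => (y.1 i).1, fun v => ⟨fun i => (y.1 i).2, y.2 v⟩⟩
      invFun := fun z => ⟨fun i => (z.1 i, (z.2 (z.1 i)).1 ⟨i, rfl⟩), fun v => by
        refine Eq.trans ?_ (z.2 v).2
        refine Finset.sum_congr rfl fun i _ => ?_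
        obtain ⟨i, rfl⟩ := i
        rfl⟩
      left_inv := fun y => rfl
      right_inv := fun z => by
        obtain ⟨f, z⟩ := z
        refine Sigma.ext rfl (heq_of_eq ?_)
        funext v
        apply Subtype.ext
        funext i
        obtain ⟨i, rfl⟩ := i
        rfl }
  rw [Nat.card_congr E, Nat.card_sigma]
  simp only [Nat.card_pi]

open Polynomial in
theorem sum_fiber_eq_zero_of_power_sums {F ι : Type*} [Field F] [DecidableEq F] [Fintype ι]
    (y v : ι → F) (n : ℕ) (hn : Fintype.card ι ≤ n) (h : ∀ l < n, ∑ i, y i * v i ^ l = 0) (w : F) :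
    ∑ i with v i = w, y i = 0 := by
  rcases isEmpty_or_nonempty ι with _ | _
  · simp
  have hP : ∀ P : F[X], P.natDegree < n → ∑ i, y i * P.eval (v i) = 0 := by
    intro P hP
    simp_rw [eval_eq_sum_range' hP, Finset.mul_sum]
    rw [Finset.sum_comm]
    refine Finset.sum_eq_zero fun l hl => ?_
    have := h l (Finset.mem_range.1 hl)
    calc _ = P.coeff l * ∑ i, y i * v i ^ l := by
          rw [Finset.mul_sum]; exact Finset.sum_congr rfl fun i _ => by ring
      _ = 0 := by rw [this, mul_zero]
  by_cases hw : w ∈ Finset.univ.image v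
  · set s := (Finset.univ.image v).erase w
    have hdeg : (∏ u ∈ s, (X - C u)).natDegree < n := by
      rw [natDegree_prod_of_monic _ _ fun u _ => monic_X_sub_C u]
      simp only [natDegree_X_sub_C, Finset.sum_const, smul_eq_mul, mul_one]
      have := Finset.card_image_le (s := Finset.univ) (f := v)
      rw [Finset.card_univ] at this
      have : s.card < _ := Finset.card_erase_lt_of_mem hw
      omega
    have h0 := hP _ hdeg
    rw [← Finset.sum_filter_add_sum_filter_not _ (fun i => v i = w)] at h0
    rw [Finset.sum_eq_zero (s := Finset.univ.filter fun i => ¬ v i = w), add_zero] at h0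
    · have hne : (∏ u ∈ s, (X - C u)).eval w ≠ 0 := by
        rw [eval_prod]
        refine Finset.prod_ne_zero_iff.2 fun u hu => ?_
        simpa [sub_eq_zero] using (Finset.ne_of_mem_erase hu).symm
      refine (mul_eq_zero.1 ?_).resolve_right hne
      rw [Finset.sum_mul, ← h0]
      exact Finset.sum_congr rfl fun i hi => by rw [(Finset.mem_filter.1 hi).2]
    · intro i hi
      rw [eval_prod, Finset.prod_eq_zero (i := v i), mul_zero]
      · simpa [s] using hi
      · simp
  · rw [Finset.filter_false_of_mem, Finset.sum_empty]
    rintro i _ rfl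
    exact hw (by simp)

theorem niho_sums_eq_zero_iff {F ι : Type*} [Field F] [DecidableEq F] [Fintype ι] (φ : F →+* F)
    (y v : ι → F) (hv : ∀ i, v i ≠ 0) (hy : ∀ i, φ (y i) * v i = y i) (hφ : ∀ i, φ (v i) * v i = 1)
    (t : ℕ) (ht : Fintype.card ι ≤ 2 * t) :
    (∀ j, 1 ≤ j → j ≤ t → ∑ i, y i * v i ^ (j - 1) = 0) ↔
      ∀ w, ∑ i with v i = w, y i = 0 := by
  constructor
  · intro h w
    have key : ∀ l < 2 * t, ∑ i, (y i * (v i)⁻¹ ^ t) * v i ^ l = 0 := by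
      intro l hl
      by_cases hlt : t ≤ l
      · rw [← h (l - t + 1) (by omega) (by omega)]
        refine Finset.sum_congr rfl fun i _ => ?_
        have := hv i
        obtain ⟨k, rfl⟩ := Nat.exists_eq_add_of_le hlt
        simp only [Nat.add_sub_cancel_left, Nat.add_sub_cancel, pow_add, inv_pow]
        field_simp
      · rw [← map_zero φ, ← h (t - l) (by omega) (by omega), map_sum]
        refine Finset.sum_congr rfl fun i _ => ?_
        have h1 := hv i
        obtain ⟨k, rfl⟩ : ∃ k, t = l + k + 1 := ⟨t - l - 1, by omega⟩
        have h3 : φ (v i) = (v i)⁻¹ := eq_inv_of_mul_eq_one_left (hφ i)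
        have h2 : φ (y i) = y i * (v i)⁻¹ := by rw [← div_eq_mul_inv, eq_div_iff h1, hy i]
        rw [map_mul, map_pow, h3, h2]
        have : l + k + 1 - l - 1 = k := by omega
        rw [this, pow_succ, pow_add, inv_pow]
        field_simp
    have := sum_fiber_eq_zero_of_power_sums _ v (2 * t) ht key w
    by_cases hw : w = 0
    · rw [Finset.filter_false_of_mem, Finset.sum_empty]
      rintro i _ rfl
      exact hv i hw
    · have h' : (∑ i with v i = w, y i) * w⁻¹ ^ t = 0 := by
        rw [← this, Finset.sum_mul]
        exact Finset.sum_congr rfl fun i hi => by rw [(Finset.mem_filter.1 hi).2]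
      exact (mul_eq_zero.1 h').resolve_right (pow_ne_zero _ (inv_ne_zero hw))
  · intro h j _ _
    rw [← Finset.sum_fiberwise_of_maps_to (s := Finset.univ) (t := Finset.univ.image v) (g := v)
      (by simp)]
    refine Finset.sum_eq_zero fun w _ => ?_
    rw [Finset.sum_congr rfl (g := fun i => y i * w ^ (j - 1))
      (fun i hi => by rw [(Finset.mem_filter.1 hi).2]), ← Finset.sum_mul, h, zero_mul]

theorem card_niho_fiberwise_solutions {F : Type*} [Field F] [Fintype F] [DecidableEq F] (q : ℕ)
    (hq : 2 ≤ q) (hF : Fintype.card F = q ^ 2) (φ : F →+* F) (hφ : ∀ x, φ x = x ^ q) (h a : ℕ)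
    (ha : (q + 1) ∣ a + h) (haq : Nat.Coprime a (q - 1)) (r : ℕ) :
    (Nat.card {x : Fin r → Fˣ //
        ∀ w : F, ∑ i with (x i : F) ^ (h * (q - 1)) = w, (x i : F) ^ a = 0} : ℚ) =
      (Nat.gcd h (q + 1) : ℚ) ^ r * ((r.factorial : ℚ) * PowerSeries.coeff r
        ((PowerSeries.mk fun n => (((q : ℚ) - 1) ^ n / q + (-1) ^ n * (1 - 1 / q)) /
          (n.factorial : ℚ)) ^ ((q + 1) / Nat.gcd h (q + 1)))) := by
  classical
  obtain ⟨q', rfl⟩ : ∃ q', q = q' + 1 := ⟨q - 1, by omega⟩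
  simp only [Nat.add_sub_cancel] at *
  set q := q' + 1 with hqq
  set g := h * q' with hg
  set e := Nat.gcd h (q + 1) with he
  have he0 : 0 < e := Nat.gcd_pos_of_pos_right _ (by omega)
  have hU : Nat.card Fˣ = q' * (q + 1) := by
    rw [Nat.card_eq_fintype_card, Fintype.card_units, hF, hqq]
    have : (q' + 1) ^ 2 = q' * (q' + 1 + 1) + 1 := by ring
    omega
  have hU1 (x : Fˣ) : x ^ (q' * (q + 1)) = 1 := by rw [← hU, pow_card_eq_one']
  set K : Subfield F := φ.eqLocusField (RingHom.id F) with hK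
  have hKmem (x : F) : x ∈ K ↔ x ^ q = x := by
    rw [hK, RingHom.mem_eqLocusField, hφ, RingHom.id_apply]
  have hKu (x : Fˣ) : (x : F) ∈ K ↔ x ^ q' = 1 := by
    rw [hKmem, hqq, ← Units.val_pow_eq_pow_val, Units.val_inj, pow_succ, mul_eq_right]
  have hcK : Fintype.card K = q := by
    have E : {s : K // s ≠ 0} ≃ (powMonoidHom q' : Fˣ →* Fˣ).ker :=
      { toFun := fun s => ⟨Units.mk0 (s.1 : F) (by simpa using s.2), by
          rw [MonoidHom.mem_ker, powMonoidHom_apply, ← hKu]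
          exact s.1.2⟩
        invFun := fun x => ⟨⟨x.1, (hKu x.1).2 x.2⟩, by
          intro h0
          exact x.1.ne_zero (congrArg Subtype.val h0)⟩
        left_inv := fun s => rfl
        right_inv := fun x => by ext; rfl }
    have h1 := Nat.card_congr E
    rw [IsCyclic.card_powMonoidHom_ker, hU, Nat.gcd_eq_right (Dvd.intro _ rfl),
      Nat.card_eq_fintype_card, Fintype.card_subtype_compl, Fintype.card_subtype_eq] at h1
    have : 0 < Fintype.card K := Fintype.card_pos
    omega
  set V := (powMonoidHom g : Fˣ →* Fˣ).range with hV
  have hcV : Fintype.card V = (q + 1) / e := by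
    rw [← Nat.card_eq_fintype_card, IsCyclic.card_powMonoidHom_range, hU, hg, mul_comm h,
      Nat.gcd_mul_left, Nat.mul_div_mul_left _ _ (by omega), Nat.gcd_comm]
  choose c hc using fun v : V => v.2
  simp only [powMonoidHom_apply] at hc
  have hkey (x : Fˣ) (hx : x ^ g = 1) : (x ^ a) ^ q' = 1 := by
    obtain ⟨k, hk⟩ := ha
    have : (x ^ a) ^ q' * x ^ g = 1 := by
      rw [← pow_mul, ← pow_add, hg, ← add_mul, hk, mul_comm, ← mul_assoc, pow_mul, hU1, one_pow]
    rwa [hx, mul_one] at this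
  have hcx (x : Fˣ) : (x * (c ⟨x ^ g, x, rfl⟩)⁻¹) ^ g = 1 := by
    rw [mul_pow, inv_pow, hc, mul_inv_cancel]
  let Φ : Fˣ → V × {s : K // s ≠ 0} := fun x =>
    (⟨x ^ g, x, rfl⟩, ⟨⟨((x * (c ⟨x ^ g, x, rfl⟩)⁻¹) ^ a : Fˣ), (hKu _).2 (hkey _ (hcx x))⟩,
      fun h0 => Units.ne_zero ((x * (c ⟨x ^ g, x, rfl⟩)⁻¹) ^ a) (congrArg Subtype.val h0)⟩)
  have hΦ (x : Fˣ) (v : V) (s : {s : K // s ≠ 0}) (u : Fˣ) (hu : (u : F) = s.1) :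
      Φ x = (v, s) ↔ x ^ g = v ∧ x ^ a = c v ^ a * u := by
    constructor
    · rintro h1
      obtain rfl : _ = v := congrArg Prod.fst h1
      refine ⟨rfl, ?_⟩
      have h2 := congrArg (fun z => ((z.2.1 : K) : F)) h1
      simp only [Φ, ← hu, Units.val_inj] at h2
      rw [← h2, mul_pow, inv_pow]
      exact (mul_inv_cancel_comm_assoc _ _).symm
    · rintro ⟨h1, h2⟩
      obtain ⟨v, hv⟩ := v
      simp only at h1
      subst h1
      refine Prod.ext rfl (Subtype.ext (Subtype.ext ?_))
      simp only [Φ, ← hu, Units.val_inj]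
      rw [mul_pow, inv_pow, h2]
      exact mul_inv_cancel_comm _ _
  set κ := Nat.card {x : Fˣ // x ^ g = 1 ∧ x ^ a = 1} with hκ
  have hfib (y) : Nat.card {x // Φ x = y} = κ := by
    obtain ⟨v, s⟩ := y
    set u : Fˣ := Units.mk0 (s.1 : F) (by simpa using s.2) with hu
    have hu1 : u ^ q' = 1 := by
      rw [← hKu]; exact s.1.2
    obtain ⟨x₀, hx1, hx2⟩ : ∃ x₀ : Fˣ, x₀ ^ g = v ∧ x₀ ^ a = c v ^ a * u := by
      obtain ⟨b, hb⟩ : ∃ b : ℤ, (q' : ℤ) ∣ a * b - 1 := by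
        have := Nat.gcd_eq_gcd_ab a q'
        rw [haq] at this
        exact ⟨Nat.gcdA a q', -Nat.gcdB a q', by push_cast at this; linarith⟩
      obtain ⟨k, hk⟩ := hb
      refine ⟨c v * u ^ b, ?_, ?_⟩
      · rw [mul_pow, hc, ← zpow_natCast (u ^ b), ← zpow_mul, mul_comm b, zpow_mul, zpow_natCast,
          hg, mul_comm h, pow_mul, hu1, one_pow, one_zpow, mul_one]
      · rw [mul_pow, ← zpow_natCast (u ^ b), ← zpow_mul, mul_comm b, eq_add_of_sub_eq hk,
          zpow_add, zpow_mul, zpow_natCast, hu1, one_zpow, one_mul, zpow_one]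
    refine Nat.card_congr ((Equiv.mulLeft x₀⁻¹).subtypeEquiv fun x => ?_)
    rw [hΦ x v s u rfl, ← hx1, ← hx2]
    simp [mul_pow, inv_mul_eq_one, eq_comm]
  have hκe : κ = e := by
    have h1 := card_fun_comp (ι := Unit) Φ κ hfib (fun _ => True)
    have h2 : Nat.card Fˣ = κ * ((q + 1) / e * q') := by
      simpa [hcV, hcK, Nat.card_eq_fintype_card, hqq, Fintype.card_subtype_compl] using h1
    have h3 : (q + 1) / e * e = q + 1 := Nat.div_mul_cancel (Nat.gcd_dvd_right _ _)
    rw [hU] at h2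
    have h4 : 0 < (q + 1) / e * q' := by
      have : 0 < (q + 1) / e := Nat.pos_of_ne_zero fun h => by rw [h] at h3; omega
      have : 0 < q' := by omega
      positivity
    apply Nat.eq_of_mul_eq_mul_right h4
    rw [← h2, ← mul_assoc, mul_comm e, h3, mul_comm]
  have hiff (x : Fin r → Fˣ) :
      (∀ w : F, ∑ i with (x i : F) ^ g = w, (x i : F) ^ a = 0) ↔
        ∀ v : V, ∑ i : {i // ((Φ ∘ x) i).1 = v}, (((Φ ∘ x) i).2 : K) = 0 := by
    have hv (v : V) : ∑ i with (x i : F) ^ g = ((v : Fˣ) : F), (x i : F) ^ a =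
        (c v : F) ^ a * ((∑ i : {i // ((Φ ∘ x) i).1 = v}, (((Φ ∘ x) i).2 : K) : K) : F) := by
      rw [AddSubmonoidClass.coe_finsetSum, Finset.mul_sum,
        Finset.sum_subtype (p := fun i => ((Φ ∘ x) i).1 = v)]
      · refine Finset.sum_congr rfl fun i _ => ?_
        have := ((hΦ (x i) v (Φ (x i)).2 (Units.mk0 _ (by simp)) rfl).1
          (Prod.ext i.2 rfl)).2
        have h1 := congrArg Units.val this
        rwa [Units.val_mul, Units.val_pow_eq_pow_val, Units.val_pow_eq_pow_val,
          Units.val_mk0] at h1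
      · intro i
        simp [Φ, Subtype.ext_iff, Units.ext_iff]
    constructor
    · intro h0 v
      have h1 := hv v
      rw [h0 (v : Fˣ)] at h1
      have := (mul_eq_zero.1 h1.symm).resolve_left (pow_ne_zero _ (Units.ne_zero _))
      exact_mod_cast this
    · intro h0 w
      by_cases hw : ∃ v : V, ((v : Fˣ) : F) = w
      · obtain ⟨v, rfl⟩ := hw
        rw [hv, h0]
        simp
      · rw [Finset.filter_false_of_mem, Finset.sum_empty]
        rintro i _ rfl
        exact hw ⟨⟨x i ^ g, x i, rfl⟩, by simp⟩
  simp_rw [hiff]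
  rw [card_fun_comp Φ κ hfib (fun y : Fin r → V × {s : K // s ≠ 0} =>
      ∀ v : V, ∑ i : {i // (y i).1 = v}, ((y i).2 : K) = 0),
    card_fiberwise_zero_sum, hκe]
  push_cast
  simp_rw [card_zero_sum, hcK]
  rw [sum_prod_card_fiber_eq_factorial_mul_coeff
    (fun n => ((q : ℚ) - 1) ^ n / q + (-1) ^ n * (1 - 1 / q)), hcV, Fintype.card_fin]

theorem pow_eq_pow_of_intModEq {G : Type*} [Group G] {n : ℕ} {x : G} (hx : x ^ n = 1) {k l : ℕ}
    (h : (k : ℤ) ≡ l [ZMOD n]) : x ^ k = x ^ l :=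
  pow_eq_pow_iff_modEq.2 ((Int.natCast_modEq_iff.1 h).of_dvd (orderOf_dvd_of_pow_eq_one hx))

/-- Appendix II: with `p` an odd prime, `q = p^m`, `F` the field with `q²` elements and
generalized Niho-type exponents `d̃_1, …, d̃_t` (with `h, Δ` odd) as in the paper, for
`0 ≤ r ≤ 2t` the number `N_r` of `r`-tuples `(x₁, …, x_r) ∈ (F_{q²}^*)^r` with
`x₁^{d̃_j} + ⋯ + x_r^{d̃_j} = 0` for all `1 ≤ j ≤ t` satisfies `N_0 = 1`, `N_1 = 0`, and
for `r ≥ 2`, `N_r = r! e^r ∑_{λ : ∑_{j≥2} jλ_j = r} C((q+1)/e, L) L! ∏_j (B_j/j!)^{λ_j}/λ_j!`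
where `L = ∑_j λ_j` and `B_j = q⁻¹(q-1)^j + (-1)^j(1-q⁻¹)`. -/
theorem stmt_13 (p m : ℕ) (hp : p.Prime) (hodd : Odd p) (hm : 0 < m)
    (q : ℕ) (hq : q = p ^ m)
    (F : Type*) [Field F] [Fintype F] (hF : Fintype.card F = q ^ 2)
    (γ : Fˣ) (hγ : ∀ x : Fˣ, x ∈ Subgroup.zpowers γ)
    (h Δ : ℕ) (hh : 0 < h) (hΔpos : 0 < Δ) (hhodd : Odd h) (hΔodd : Odd Δ)
    (hhq : ¬ (q + 1) ∣ h) (hΔ : Nat.gcd Δ (q - 1) = 1)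
    (e : ℕ) (he : e = Nat.gcd h (q + 1))
    (t : ℕ) (ht1 : 1 ≤ t) (ht : 2 * e * t ≤ q + 1)
    (d : ℕ → ℕ) (s : ℕ → ℤ)
    (hdpos : ∀ j, 1 ≤ j → j ≤ t → 0 < d j)
    (hs : ∀ j, 1 ≤ j → j ≤ t →
      s j ≡ (j : ℤ) * h + ((Δ : ℤ) - h) / 2 [ZMOD ((q : ℤ) + 1)])
    (hd : ∀ j, 1 ≤ j → j ≤ t →
      (d j : ℤ) ≡ s j * ((q : ℤ) - 1) + Δ [ZMOD ((q : ℤ) ^ 2 - 1)])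
    (r : ℕ) (hr : r ≤ 2 * t)
    (N : ℕ)
    (hN : N = Nat.card
      {x : Fin r → Fˣ // ∀ j, 1 ≤ j → j ≤ t → ∑ i, ((x i : F)) ^ d j = 0}) :
    (r = 0 → N = 1) ∧ (r = 1 → N = 0) ∧
    (2 ≤ r → (N : ℚ) =
      (r.factorial : ℚ) * (e : ℚ) ^ r *
        ∑ fl ∈ Finset.univ.filter (fun fl : Fin (r + 1) → Fin (r + 1) =>
            (∀ j : Fin (r + 1), (j : ℕ) < 2 → fl j = 0) ∧
            ∑ j : Fin (r + 1), (j : ℕ) * (fl j : ℕ) = r),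
          (((q + 1) / e).choose (∑ j, (fl j : ℕ)) : ℚ) *
            ((∑ j, (fl j : ℕ)).factorial : ℚ) *
            ∏ j : Fin (r + 1),
              ((((q : ℚ) - 1) ^ (j : ℕ) / q + (-1) ^ (j : ℕ) * (1 - 1 / q)) /
                  ((j : ℕ).factorial : ℚ)) ^ (fl j : ℕ) /
                ((fl j : ℕ).factorial : ℚ)) := by
  classical
  have hq3 : 3 ≤ q := by
    have h3 : 3 ≤ p := by
      have := hp.two_le
      obtain ⟨k, rfl⟩ := hodd
      omega
    rw [hq]
    exact h3.trans (Nat.le_self_pow hm.ne' p)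
  have : Fact p.Prime := ⟨hp⟩
  have : CharP F p := by
    obtain ⟨p', hp'⟩ := CharP.exists F
    obtain ⟨n, hp1, hn⟩ := FiniteField.card F p'
    have hdvd : p' ∣ p := by
      refine hp1.dvd_of_dvd_pow (n := m * 2) ?_
      rw [pow_mul, ← hq, ← hF, hn]
      exact dvd_pow_self _ n.ne_zero
    rwa [(Nat.prime_dvd_prime_iff_eq hp1 hp).1 hdvd] at hp'
  set φ : F →+* F := iterateFrobenius F p m
  have hφ (x : F) : φ x = x ^ q := by rw [iterateFrobenius_def, hq]
  have hcard (x : Fˣ) : x ^ (q ^ 2 - 1) = 1 := by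
    rw [← hF, ← Fintype.card_units, pow_card_eq_one]
  have hQ : ((q ^ 2 - 1 : ℕ) : ℤ) = ((q : ℤ) - 1) * (q + 1) := by
    rw [Nat.cast_sub (Nat.one_le_pow _ _ (by omega))]
    push_cast
    ring
  have hq1 : ((q - 1 : ℕ) : ℤ) = (q : ℤ) - 1 := by
    rw [Nat.cast_sub (by omega)]; simp
  have hhalf : 2 * (((Δ : ℤ) - h) / 2) = Δ - h := by
    obtain ⟨k, hk⟩ := hhodd
    obtain ⟨l, hl⟩ := hΔodd
    omega
  have hs' (j : ℕ) (h1 : 1 ≤ j) (h2 : j ≤ t) :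
      ∃ k : ℤ, s j = j * h + ((Δ : ℤ) - h) / 2 + (q + 1) * k := by
    obtain ⟨k, hk⟩ := (Int.modEq_iff_dvd.1 (hs j h1 h2).symm)
    exact ⟨k, by linarith⟩
  have hd' (j : ℕ) (h1 : 1 ≤ j) (h2 : j ≤ t) :
      ∃ k : ℤ, (d j : ℤ) =
        (j * h + ((Δ : ℤ) - h) / 2) * (q - 1) + Δ + (q - 1) * (q + 1) * k := by
    obtain ⟨k, hk⟩ := hs' j h1 h2
    obtain ⟨l, hl⟩ := (Int.modEq_iff_dvd.1 (hd j h1 h2).symm)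
    refine ⟨k + l, ?_⟩
    rw [hk] at hl
    linear_combination hl
  obtain ⟨k₁, hk₁⟩ := hd' 1 le_rfl ht1
  push_cast at hk₁
  have hpow (j : ℕ) (h1 : 1 ≤ j) (h2 : j ≤ t) (x : Fˣ) :
      x ^ d j = x ^ d 1 * (x ^ (h * (q - 1))) ^ (j - 1) := by
    rw [← pow_mul, ← pow_add]
    refine pow_eq_pow_of_intModEq (hcard x) (Int.modEq_iff_dvd.2 ?_)
    obtain ⟨k, hk⟩ := hd' j h1 h2
    rw [hQ]
    push_cast [hq1, Nat.cast_sub h1]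
    exact ⟨k₁ - k, by rw [hk, hk₁]; ring⟩
  have hdvd : (q + 1) ∣ d 1 + h := by
    zify
    refine ⟨h + ((Δ : ℤ) - h) / 2 + (q - 1) * k₁, ?_⟩
    rw [hk₁]
    linear_combination -hhalf
  have hcop : Nat.Coprime (d 1) (q - 1) := by
    have h1 : (d 1 : ℤ) ≡ Δ [ZMOD (q - 1 : ℕ)] := by
      refine Int.modEq_iff_dvd.2 ?_
      rw [hk₁, hq1]
      exact ⟨-(h + ((Δ : ℤ) - h) / 2) - (q + 1) * k₁, by ring⟩
    exact ((Int.natCast_modEq_iff.1 h1).gcd_eq).trans hΔ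
  have hiff (x : Fin r → Fˣ) : (∀ j, 1 ≤ j → j ≤ t → ∑ i, ((x i : F)) ^ d j = 0) ↔
      ∀ w : F, ∑ i with (x i : F) ^ (h * (q - 1)) = w, (x i : F) ^ d 1 = 0 := by
    rw [← niho_sums_eq_zero_iff φ (fun i => (x i : F) ^ d 1)
      (fun i => (x i : F) ^ (h * (q - 1))) (fun i => pow_ne_zero _ (Units.ne_zero _)) ?_ ?_ t
      (by simpa using hr)]
    · refine forall₃_congr fun j h1 h2 => ?_
      rw [Finset.sum_congr rfl fun i _ => ?_]
      exact_mod_cast congrArg Units.val (hpow j h1 h2 (x i))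
    · intro i
      simp only [hφ]
      norm_cast
      rw [← pow_mul, ← pow_add]
      refine pow_eq_pow_of_intModEq (hcard _) (Int.modEq_iff_dvd.2 ?_)
      obtain ⟨k, hk⟩ := hdvd
      rw [hQ]
      zify at hk
      push_cast [hq1]
      exact ⟨-k, by linear_combination -((q : ℤ) - 1) * hk⟩
    · intro i
      simp only [hφ]
      norm_cast
      rw [← pow_mul, ← pow_add, Units.val_eq_one, ← pow_zero (x i)]
      refine pow_eq_pow_of_intModEq (hcard _) (Int.modEq_iff_dvd.2 ?_)
      rw [hQ]
      push_cast [hq1]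
      exact ⟨-h, by ring⟩
  have hq0 : (q : ℚ) ≠ 0 := by exact_mod_cast (by omega : q ≠ 0)
  simp_rw [hiff] at hN
  have hmain := card_niho_fiberwise_solutions q (by omega) hF φ hφ h (d 1) hdvd hcop r
  rw [← hN, ← he, coeff_pow_eq_sum_partitions _ (by simp) (by simp; field_simp; ring),
    ← mul_assoc, mul_comm ((e : ℚ) ^ r)] at hmain
  refine ⟨?_, ?_, fun _ => hmain⟩
  · rintro rfl
    simp [hN]
  · rintro rfl
    rw [hN, Nat.card_eq_zero]
    refine Or.inl ⟨fun x => ?_⟩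
    have := (hiff x.1).2 x.2 1 le_rfl ht1
    simp at this
end

section
/- For any t with 1 ≤ t ≤ (q+1)/(2e), the number of pairs (x_1, x_2) ∈ (F_{q²}^*)² satisfying x_1^{d_j} + x_2^{d_j} = 0 simultaneously for all 0 ≤ j ≤ t equals e(q² − 1). -/
/-- The residues of a Niho-type exponent `d` modulo `q - 1` and modulo `q + 1`. -/
lemma niho_exponent_modEq {q d s a Δ : ℤ} (hs : 2 * s ≡ 2 * a + Δ [ZMOD (q + 1)])
    (hd : d ≡ s * (q - 1) + Δ [ZMOD (q ^ 2 - 1)]) :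
    d ≡ Δ [ZMOD (q - 1)] ∧ q + 1 ∣ d + 2 * a := by
  rw [Int.modEq_comm] at hd
  obtain ⟨k, hk⟩ := hd.dvd
  obtain ⟨l, hl⟩ := hs.dvd
  refine ⟨(Int.modEq_iff_dvd.2 ⟨s + (q + 1) * k, by linear_combination hk⟩).symm,
    ⟨s + l + (q - 1) * k, by linear_combination hk + hl⟩⟩

/-- A divisor of `q² - 1` divides all the Niho-type exponents `d 0, …, d t` exactly when it
divides `gcd h (q + 1)`. -/
lemma forall_dvd_niho_exponent_iff {q h Δ t o : ℕ} (hq : Even q) (hq0 : 0 < q)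
    (hΔ : Nat.gcd Δ (q - 1) = 1) (ht : 1 ≤ t) {d : ℕ → ℕ} {s : ℕ → ℤ}
    (hs : ∀ j ≤ t, 2 * s j ≡ 2 * (j : ℤ) * h + Δ [ZMOD ((q : ℤ) + 1)])
    (hd : ∀ j ≤ t, (d j : ℤ) ≡ s j * ((q : ℤ) - 1) + Δ [ZMOD ((q : ℤ) ^ 2 - 1)])
    (ho : o ∣ q ^ 2 - 1) :
    (∀ j ≤ t, o ∣ d j) ↔ o ∣ Nat.gcd h (q + 1) := by
  have key : ∀ j ≤ t, (d j : ℤ) ≡ Δ [ZMOD ((q : ℤ) - 1)] ∧ q + 1 ∣ d j + 2 * (j * h) := by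
    intro j hj
    have := niho_exponent_modEq (a := j * h) (by simpa only [mul_assoc] using hs j hj) (hd j hj)
    exact ⟨this.1, by exact_mod_cast this.2⟩
  constructor
  · intro H
    have hcop : Nat.Coprime o (q - 1) := by
      have h0 : d 0 ≡ Δ [MOD (q - 1)] := by
        have := (key 0 (Nat.zero_le t)).1
        rw [← Int.natCast_modEq_iff]
        push_cast [Nat.cast_sub hq0]
        exact this
      exact Nat.Coprime.coprime_dvd_left (H 0 (Nat.zero_le t)) (h0.gcd_eq.trans hΔ)
    have hoq : o ∣ q + 1 := by
      refine hcop.dvd_of_dvd_mul_right ?_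
      rwa [← Nat.sq_sub_sq q 1, one_pow]
    have ho2 : Nat.Coprime o 2 :=
      Nat.Coprime.coprime_dvd_left hoq (Nat.coprime_two_right.2 hq.add_one)
    have h1 : o ∣ 2 * (1 * h) := (Nat.dvd_add_right (H 1 ht)).1 (hoq.trans (key 1 ht).2)
    rw [one_mul] at h1
    exact Nat.dvd_gcd (ho2.dvd_of_dvd_mul_left h1) hoq
  · intro H j hj
    have hoh : o ∣ 2 * (j * h) := ((H.trans (Nat.gcd_dvd_left _ _)).mul_left j).mul_left 2
    exact (Nat.dvd_add_left hoh).1 ((H.trans (Nat.gcd_dvd_right _ _)).trans (key j hj).2)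

/-- The pairs of elements of a group whose quotient satisfies `p` are parametrized by that
quotient and the second element. -/
def pairDivEquiv {G : Type*} [Group G] (p : G → Prop) :
    {x : Fin 2 → G // p (x 0 / x 1)} ≃ {y : G // p y} × G where
  toFun x := (⟨x.1 0 / x.1 1, x.2⟩, x.1 1)
  invFun y := ⟨![y.1.1 * y.2, y.2], by simpa using y.1.2⟩
  left_inv x := by
    ext i
    fin_cases i <;> simp
  right_inv y := by simp


/-- `N_2 = e(q² - 1)`: with `p = 2`, `q = 2^m`, `F` the field with `q²` elements and
Niho-type exponents `d_0, …, d_t` as in the paper, for `1 ≤ t ≤ (q+1)/(2e)` the number of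
pairs `(x₁, x₂) ∈ (F_{q²}^*)²` with `x₁^{d_j} + x₂^{d_j} = 0` for all `0 ≤ j ≤ t` equals
`e(q² - 1)`. -/
theorem stmt_14 (m : ℕ) (hm : 0 < m) (q : ℕ) (hq : q = 2 ^ m)
    (F : Type*) [Field F] [Fintype F] (hF : Fintype.card F = q ^ 2)
    (γ : Fˣ) (hγ : ∀ x : Fˣ, x ∈ Subgroup.zpowers γ)
    (h Δ : ℕ) (hh : 0 < h) (hΔpos : 0 < Δ)
    (hhq : ¬ (q + 1) ∣ h) (hΔ : Nat.gcd Δ (q - 1) = 1)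
    (e : ℕ) (he : e = Nat.gcd h (q + 1))
    (t : ℕ) (ht1 : 1 ≤ t) (ht : 2 * e * t ≤ q + 1)
    (d : ℕ → ℕ) (s : ℕ → ℤ)
    (hdpos : ∀ j ≤ t, 0 < d j)
    (hs : ∀ j ≤ t, 2 * s j ≡ 2 * (j : ℤ) * h + Δ [ZMOD ((q : ℤ) + 1)])
    (hd : ∀ j ≤ t, (d j : ℤ) ≡ s j * ((q : ℤ) - 1) + Δ [ZMOD ((q : ℤ) ^ 2 - 1)]) :
    Nat.card {x : Fin 2 → Fˣ // ∀ j ≤ t, ∑ i, ((x i : F)) ^ d j = 0} =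
      e * (q ^ 2 - 1) := by
  have hqe : Even q := hq ▸ (even_two.pow_of_ne_zero hm.ne')
  have hq0 : 0 < q := hq ▸ Nat.two_pow_pos m
  have hcard : Nat.card Fˣ = q ^ 2 - 1 := by
    rw [Nat.card_units, Nat.card_eq_fintype_card, hF]
  have h2 : (2 : F) = 0 := by
    have h0 : (Fintype.card F : F) = 0 := Nat.cast_card_eq_zero F
    rw [hF, hq] at h0
    push_cast at h0
    exact eq_zero_of_pow_eq_zero (eq_zero_of_pow_eq_zero h0)
  have : CharP F 2 := CharTwo.of_one_ne_zero_of_two_eq_zero one_ne_zero h2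
  have hiff : ∀ x : Fin 2 → Fˣ, (∀ j ≤ t, ∑ i, ((x i : F)) ^ d j = 0) ↔
      x 0 / x 1 ∈ (powMonoidHom e : Fˣ →* Fˣ).ker := by
    intro x
    rw [MonoidHom.mem_ker, powMonoidHom_apply, ← orderOf_dvd_iff_pow_eq_one, he,
      ← forall_dvd_niho_exponent_iff hqe hq0 hΔ ht1 hs hd (hcard ▸ orderOf_dvd_natCard _)]
    refine forall₂_congr fun j _ => ?_
    rw [Fin.sum_univ_two, CharTwo.add_eq_zero, orderOf_dvd_iff_pow_eq_one, div_pow, div_eq_one]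
    norm_cast
  have he2 : e ∣ q ^ 2 - 1 := by
    rw [he, ← one_pow 2, Nat.sq_sub_sq]
    exact (Nat.gcd_dvd_right _ _).mul_right _
  rw [Nat.card_congr ((Equiv.subtypeEquivRight hiff).trans (pairDivEquiv _)), Nat.card_prod,
    hcard]
  congr 1
  exact (IsCyclic.card_powMonoidHom_ker Fˣ e).trans (by rw [hcard, Nat.gcd_eq_right he2])
end
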